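/- Let G be a finite complex reflection group. Then ℓ(g) = codim(g) for all g ∈ G if and only if every atom of the codimension order on G is a reflection. -/

import Mathlib

open Module

noncomputable section

variable {V : Type*} [AddCommGroup V] [Module ℂ V] [FiniteDimensional ℂ V]

/-- The fixed point space of a linear automorphism. -/
def fixedSpace (g : V ≃ₗ[ℂ] V) : Submodule ℂ V :=
  LinearMap.ker ((g : V →ₗ[ℂ] V) - LinearMap.id)

/-- codim(g) = dim V - dim V^g. -/
def codim (g : V ≃ₗ[ℂ] V) : ℕ :=
  finrank ℂ V - finrank ℂ (fixedSpace g)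

/-- A reflection: a nonidentity element fixing a hyperplane pointwise. -/
def IsReflection (g : V ≃ₗ[ℂ] V) : Prop :=
  g ≠ 1 ∧ finrank ℂ (fixedSpace g) + 1 = finrank ℂ V

/-- Reflection length: minimal number of reflections of `G` whose product is `g`. -/
def reflLength (G : Subgroup (V ≃ₗ[ℂ] V)) (g : G) : ℕ :=
  sInf {k | ∃ l : List G, (∀ s ∈ l, IsReflection (s : V ≃ₗ[ℂ] V)) ∧ l.length = k ∧ l.prod = g}

/-- `G` is generated by its reflections. -/
def IsGeneratedByReflections (G : Subgroup (V ≃ₗ[ℂ] V)) : Prop :=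
  ∀ g : G, ∃ l : List G, (∀ s ∈ l, IsReflection (s : V ≃ₗ[ℂ] V)) ∧ l.prod = g

/-- The codimension order: a ≤⊥ c iff codim(a) + codim(a⁻¹c) = codim(c). -/
def codimLe (G : Subgroup (V ≃ₗ[ℂ] V)) (a c : G) : Prop :=
  codim (a : V ≃ₗ[ℂ] V) + codim ((a⁻¹ * c : G) : V ≃ₗ[ℂ] V) = codim (c : V ≃ₗ[ℂ] V)

/-- An atom of the codimension order: a minimal nonidentity element. -/
def IsCodimAtom (G : Subgroup (V ≃ₗ[ℂ] V)) (g : G) : Prop :=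
  g ≠ 1 ∧ ∀ h : G, h ≠ 1 → h ≠ g → ¬ codimLe G h g

lemma finrank_fixed_add_codim (g : V ≃ₗ[ℂ] V) :
    finrank ℂ (fixedSpace g) + codim g = finrank ℂ V := by
  have := Submodule.finrank_le (fixedSpace g)
  unfold codim
  omega

lemma codim_one' : codim (1 : V ≃ₗ[ℂ] V) = 0 := by
  have h : fixedSpace (1 : V ≃ₗ[ℂ] V) = ⊤ := by
    ext x
    simp [fixedSpace]
  unfold codim
  rw [h, finrank_top]
  omega

lemma eq_one_of_codim {g : V ≃ₗ[ℂ] V} (hg : codim g = 0) : g = 1 := by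
  have h1 := finrank_fixed_add_codim g
  have h2 : fixedSpace g = ⊤ := Submodule.eq_top_of_finrank_eq (by omega)
  ext x
  have hx : x ∈ fixedSpace g := by rw [h2]; trivial
  simpa [fixedSpace, sub_eq_zero] using hx

lemma codim_mul_le (g h : V ≃ₗ[ℂ] V) : codim (g * h) ≤ codim g + codim h := by
  have hle : fixedSpace g ⊓ fixedSpace h ≤ fixedSpace (g * h) := by
    rintro x ⟨hx, hy⟩
    simp only [fixedSpace, SetLike.mem_coe, LinearMap.mem_ker, LinearMap.sub_apply,
      LinearEquiv.coe_coe, LinearMap.id_apply, sub_eq_zero, LinearEquiv.mul_apply] at *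
    rw [hy, hx]
  have h1 := Submodule.finrank_mono hle
  have h2 := Submodule.finrank_sup_add_finrank_inf_eq (fixedSpace g) (fixedSpace h)
  have h3 := Submodule.finrank_le (fixedSpace g ⊔ fixedSpace h)
  have := finrank_fixed_add_codim g
  have := finrank_fixed_add_codim h
  have := finrank_fixed_add_codim (g * h)
  omega

lemma codim_refl {g : V ≃ₗ[ℂ] V} (hg : IsReflection g) : codim g = 1 := by
  have := finrank_fixed_add_codim g
  have := hg.2
  omega

lemma codim_prod_le (G : Subgroup (V ≃ₗ[ℂ] V)) (l : List G)
    (hl : ∀ s ∈ l, IsReflection (s : V ≃ₗ[ℂ] V)) :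
    codim (l.prod : V ≃ₗ[ℂ] V) ≤ l.length := by
  induction l with
  | nil => simp [codim_one']
  | cons a t ih =>
    have h1 := ih (fun s hs => hl s (List.mem_cons_of_mem _ hs))
    have h2 := codim_refl (hl a List.mem_cons_self)
    have h3 := codim_mul_le (a : V ≃ₗ[ℂ] V) (t.prod : V ≃ₗ[ℂ] V)
    simp only [List.prod_cons, Subgroup.coe_mul, List.length_cons]
    omega

lemma exists_list_codim (G : Subgroup (V ≃ₗ[ℂ] V))
    (hA : ∀ g : G, IsCodimAtom G g → IsReflection (g : V ≃ₗ[ℂ] V)) (n : ℕ) :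
    ∀ g : G, codim (g : V ≃ₗ[ℂ] V) = n → ∃ l : List G,
      (∀ s ∈ l, IsReflection (s : V ≃ₗ[ℂ] V)) ∧ l.length = n ∧ l.prod = g := by
  induction n using Nat.strong_induction_on with
  | _ n ih =>
    intro g hg
    by_cases h1 : g = 1
    · subst h1
      refine ⟨[], by simp, ?_, by simp⟩
      rw [← hg]
      simp [codim_one']
    by_cases ha : IsCodimAtom G g
    · have hr := hA g ha
      refine ⟨[g], by simpa using hr, ?_, by simp⟩
      rw [← hg, codim_refl hr]
      rfl
    · have : ∃ h : G, h ≠ 1 ∧ h ≠ g ∧ codimLe G h g := by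
        by_contra hc
        exact ha ⟨h1, fun h e1 e2 e3 => hc ⟨h, e1, e2, e3⟩⟩
      obtain ⟨h, e1, e2, e3⟩ := this
      have p1 : codim (h : V ≃ₗ[ℂ] V) ≠ 0 := fun e => e1 (Subtype.ext (eq_one_of_codim e))
      have p2 : codim ((h⁻¹ * g : G) : V ≃ₗ[ℂ] V) ≠ 0 := fun e =>
        e2 (inv_mul_eq_one.1 (Subtype.ext (eq_one_of_codim e)))
      unfold codimLe at e3
      obtain ⟨l, a1, a2, a3⟩ := ih _ (by omega) h rfl
      obtain ⟨m, b1, b2, b3⟩ := ih _ (by omega) (h⁻¹ * g) rfl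
      refine ⟨l ++ m, ?_, ?_, ?_⟩
      · intro s hs
        rcases List.mem_append.1 hs with hs | hs
        · exact a1 s hs
        · exact b1 s hs
      · rw [List.length_append, a2, b2, e3, hg]
      · rw [List.prod_append, a3, b3, mul_inv_cancel_left]

theorem length_eq_codim_iff_atoms_are_reflections (G : Subgroup (V ≃ₗ[ℂ] V)) [Finite G]
    (hG : IsGeneratedByReflections G) :
    (∀ g : G, reflLength G g = codim (g : V ≃ₗ[ℂ] V)) ↔
      (∀ g : G, IsCodimAtom G g → IsReflection (g : V ≃ₗ[ℂ] V)) := by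
  constructor
  · intro hL g hg
    have hne : {k | ∃ l : List G, (∀ s ∈ l, IsReflection (s : V ≃ₗ[ℂ] V)) ∧ l.length = k ∧
        l.prod = g}.Nonempty := by
      obtain ⟨l, h1, h2⟩ := hG g
      exact ⟨_, l, h1, rfl, h2⟩
    obtain ⟨l, h1, h2, h3⟩ := Nat.sInf_mem hne
    have h2' : l.length = codim (g : V ≃ₗ[ℂ] V) := h2.trans (hL g)
    cases l with
    | nil => exact absurd h3.symm hg.1
    | cons a t =>
      have ha := h1 a List.mem_cons_self
      have ht := codim_prod_le G t (fun s hs => h1 s (List.mem_cons_of_mem _ hs))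
      have hc := codim_refl ha
      rw [List.prod_cons] at h3
      have hle := codim_mul_le (a : V ≃ₗ[ℂ] V) (t.prod : V ≃ₗ[ℂ] V)
      rw [← Subgroup.coe_mul, h3] at hle
      rw [List.length_cons] at h2'
      by_cases hag : a = g
      · exact hag ▸ ha
      · refine absurd ?_ (hg.2 a (fun e => ha.1 (by rw [e]; rfl)) hag)
        unfold codimLe
        have : a⁻¹ * g = t.prod := by rw [← h3, inv_mul_cancel_left]
        rw [this]
        omega
  · intro hA g
    obtain hl := exists_list_codim G hA _ g rfl
    apply le_antisymm
    · exact Nat.sInf_le hl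
    · refine le_csInf ⟨_, hl⟩ ?_
      rintro k ⟨l, h1, rfl, rfl⟩
      exact codim_prod_le G l h1
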